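/- For a fixed valid date range, the total count of valid encoded dates equals the sum over years of days per year: the number of integers v with 0 ≤ v ≤ 9999·10⁴ + 12·10² + 31 such that decoding v via (⌊v/10⁴⌋, ⌊(v%10⁴)/10²⌋, v%10²) yields a valid date equals Σ_{y=0}^{9999} (365 + (1 if LeapYear(y) else 0)). -/

import Mathlib

def LeapYear (y : ℕ) : Prop := y % 4 = 0 ∧ (y % 100 ≠ 0 ∨ y % 400 = 0)

instance : DecidablePred LeapYear := fun _ => by unfold LeapYear; infer_instance

def daysIn (y m : ℕ) : ℕ :=
  if m = 2 then 28 + (if LeapYear y then 1 else 0)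
  else if m = 4 ∨ m = 6 ∨ m = 9 ∨ m = 11 then 30
  else 31

def ValidDecode (v : ℕ) : Prop :=
  v / 10 ^ 4 ≤ 9999 ∧
  1 ≤ (v % 10 ^ 4) / 10 ^ 2 ∧ (v % 10 ^ 4) / 10 ^ 2 ≤ 12 ∧
  1 ≤ v % 10 ^ 2 ∧ v % 10 ^ 2 ≤ daysIn (v / 10 ^ 4) ((v % 10 ^ 4) / 10 ^ 2)

instance : DecidablePred ValidDecode := fun _ => by unfold ValidDecode; infer_instance

theorem daysIn_le (y m : ℕ) : daysIn y m ≤ 31 := by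
  unfold daysIn
  split_ifs <;> omega

theorem sum_daysIn (y : ℕ) :
    ∑ m ∈ Finset.Icc 1 12, daysIn y m = 365 + if LeapYear y then 1 else 0 := by
  have h : Finset.Icc 1 12 = ({1, 2, 3, 4, 5, 6, 7, 8, 9, 10, 11, 12} : Finset ℕ) := by decide
  rw [h]
  by_cases hy : LeapYear y <;> simp [daysIn, hy]

theorem card_key (N K : ℕ) (hN : N = 9999 * 10 ^ 4 + 12 * 10 ^ 2 + 31) (hK : K = 10000) :
    ((Finset.Icc 0 N).filter ValidDecode).card =
      ((Finset.range K).sigma fun y =>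
        (Finset.Icc 1 12).sigma fun m => Finset.Icc 1 (daysIn y m)).card := by
    refine Finset.card_bij'
      (fun v _ => ⟨v / 10 ^ 4, (v % 10 ^ 4) / 10 ^ 2, v % 10 ^ 2⟩)
      (fun p _ => p.1 * 10 ^ 4 + p.2.1 * 10 ^ 2 + p.2.2) ?_ ?_ ?_ ?_
    · intro v hv
      obtain ⟨h1, h2, h3, h4, h5⟩ := (Finset.mem_filter.mp hv).2
      simp only [Finset.mem_sigma, Finset.mem_range, Finset.mem_Icc]
      exact ⟨by omega, ⟨h2, h3⟩, h4, h5⟩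
    · rintro ⟨y, m, d⟩ hp
      simp only [Finset.mem_sigma, Finset.mem_range, Finset.mem_Icc] at hp
      obtain ⟨hy, ⟨hm1, hm2⟩, hd1, hd2⟩ := hp
      have hd := daysIn_le y m
      have e1 : (y * 10 ^ 4 + m * 10 ^ 2 + d) / 10 ^ 4 = y := by omega
      have e2 : (y * 10 ^ 4 + m * 10 ^ 2 + d) % 10 ^ 4 / 10 ^ 2 = m := by omega
      have e3 : (y * 10 ^ 4 + m * 10 ^ 2 + d) % 10 ^ 2 = d := by omega
      refine Finset.mem_filter.mpr ⟨Finset.mem_Icc.mpr ⟨Nat.zero_le _, ?_⟩, ?_⟩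
      · show y * 10 ^ 4 + m * 10 ^ 2 + d ≤ _
        omega
      · show ValidDecode (y * 10 ^ 4 + m * 10 ^ 2 + d)
        unfold ValidDecode
        rw [e1, e2, e3]
        exact ⟨by omega, hm1, hm2, hd1, hd2⟩
    · intro v _
      show v / 10 ^ 4 * 10 ^ 4 + v % 10 ^ 4 / 10 ^ 2 * 10 ^ 2 + v % 10 ^ 2 = v
      omega
    · rintro ⟨y, m, d⟩ hp
      simp only [Finset.mem_sigma, Finset.mem_range, Finset.mem_Icc] at hp
      obtain ⟨hy, ⟨hm1, hm2⟩, hd1, hd2⟩ := hp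
      have hd := daysIn_le y m
      have e1 : (y * 10 ^ 4 + m * 10 ^ 2 + d) / 10 ^ 4 = y := by omega
      have e2 : (y * 10 ^ 4 + m * 10 ^ 2 + d) % 10 ^ 4 / 10 ^ 2 = m := by omega
      have e3 : (y * 10 ^ 4 + m * 10 ^ 2 + d) % 10 ^ 2 = d := by omega
      simp only [e1, e2, e3]

theorem count_valid_encoded_dates :
    ((Finset.Icc 0 (9999 * 10 ^ 4 + 12 * 10 ^ 2 + 31)).filter ValidDecode).card =
      ∑ y ∈ Finset.range 10000, (365 + if LeapYear y then 1 else 0) := by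
  rw [card_key _ 10000 rfl rfl, Finset.card_sigma]
  refine Finset.sum_congr rfl fun y _ => ?_
  rw [Finset.card_sigma, ← sum_daysIn y]
  refine Finset.sum_congr rfl fun m _ => ?_
  rw [Nat.card_Icc, Nat.add_sub_cancel]
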